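/- There exists a constant C > 0 such that for every smooth function u on [0,∞)×ℝ³ with u(t,·) compactly supported for each t, and for all t ≥ 0 and x ∈ ℝ³, |u(t,x)| ≤ C (1+r)^{−1} Σ_{|a|≤2} ‖Γ^a u(t,·)‖, where the sum runs over all compositions of at most two of the vector fields Γ. -/

import Mathlib

noncomputable section
open MeasureTheory Real Set

/-- Euclidean space ℝ³. -/
abbrev E3 : Type := EuclideanSpace ℝ (Fin 3)
/-- A space-time point (t, x) ∈ ℝ × ℝ³. -/
abbrev Pt : Type := ℝ × E3

/-- Time derivative ∂ₜ. -/
def dt (f : Pt → ℝ) (p : Pt) : ℝ := fderiv ℝ f p (1, 0)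
/-- Spatial derivative ∂ᵢ. -/
def dxi (i : Fin 3) (f : Pt → ℝ) (p : Pt) : ℝ := fderiv ℝ f p (0, EuclideanSpace.single i 1)

/-- The vector fields Γ = (∂ₜ, ∂₁, ∂₂, ∂₃, Ω₁, Ω₂, Ω₃, S), where Ω = x ∧ ∇ are the
rotations and S = t∂ₜ + Σ xₖ∂ₖ is the scaling field. -/
def Gam : Fin 8 → (Pt → ℝ) → Pt → ℝ :=
  ![dt, dxi 0, dxi 1, dxi 2,
    fun f p => p.2 1 * dxi 2 f p - p.2 2 * dxi 1 f p,
    fun f p => p.2 2 * dxi 0 f p - p.2 0 * dxi 2 f p,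
    fun f p => p.2 0 * dxi 1 f p - p.2 1 * dxi 0 f p,
    fun f p => p.1 * dt f p + ∑ k, p.2 k * dxi k f p]

/-- The composition Γ^a corresponding to a word `a` in the eight fields. -/
def GamWord : List (Fin 8) → (Pt → ℝ) → Pt → ℝ
  | [], f => f
  | k :: l, f => Gam k (GamWord l f)

/-- The first-order derivatives ∂ = (∂ₜ, ∂₁, ∂₂, ∂₃). -/
def Dop : Fin 4 → (Pt → ℝ) → Pt → ℝ := ![dt, dxi 0, dxi 1, dxi 2]

/-- The composition ∂^a corresponding to a word `a` in the four derivatives. -/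
def DWord : List (Fin 4) → (Pt → ℝ) → Pt → ℝ
  | [], f => f
  | k :: l, f => Dop k (DWord l f)

/-- L² norm in the space variable. -/
def L2norm (f : E3 → ℝ) : ℝ := Real.sqrt (∫ x : E3, (f x) ^ 2)

/-- The d'Alembertian □ = ∂ₜ² - Δ. -/
def box (f : Pt → ℝ) (p : Pt) : ℝ :=
  dt (fun q => dt f q) p - ∑ i, dxi i (fun q => dxi i f q) p

lemma oneD (φ φ1 φ2 : ℝ → ℝ) (h1 : ∀ s, HasDerivAt φ (φ1 s) s)
    (h2 : ∀ s, HasDerivAt φ1 (φ2 s) s) (hc : Continuous φ2) :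
    (φ 0) ^ 2 ≤ ∫ s in (0:ℝ)..1, s ^ 2 * (21 * (φ2 s ^ 2 + φ1 s ^ 2 + φ s ^ 2)) := by
  have c0 : Continuous φ := continuous_iff_continuousAt.2 fun s => (h1 s).continuousAt
  have c1 : Continuous φ1 := continuous_iff_continuousAt.2 fun s => (h2 s).continuousAt
  set g : ℝ → ℝ := fun s => s * ((1 - s) ^ 2 * φ2 s - 4 * (1 - s) * φ1 s + 2 * φ s) with hg
  have cg : Continuous g := by rw [hg]; fun_prop
  have I1 : ∫ s in (0:ℝ)..1, g s = φ 0 := by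
    have := intervalIntegral.integral_eq_sub_of_hasDerivAt (a := 0) (b := 1)
      (f := fun s => s * ((1 - s) ^ 2 * φ1 s - 2 * (1 - s) * φ s) - (1 - s) ^ 2 * φ s) (f' := g)
      (fun s _ => by
        have hs : HasDerivAt (fun s : ℝ => 1 - s) (-1) s := by
          simpa using (hasDerivAt_id s).const_sub 1
        have := (((hasDerivAt_id s).mul (((hs.pow 2).mul (h2 s)).sub
          ((hs.const_mul 2).mul (h1 s)))).sub ((hs.pow 2).mul (h1 s)))
        refine this.congr_deriv ?_
        simp [hg]; ring) (cg.intervalIntegrable _ _)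
    rw [this]; simp
  have I2 : (φ 0) ^ 2 ≤ ∫ s in (0:ℝ)..1, g s ^ 2 := by
    have h0 : 0 ≤ ∫ s in (0:ℝ)..1, (g s - φ 0) ^ 2 :=
      intervalIntegral.integral_nonneg (by norm_num) fun s _ => sq_nonneg _
    have e : ∫ s in (0:ℝ)..1, (g s - φ 0) ^ 2 =
        (∫ s in (0:ℝ)..1, g s ^ 2) - 2 * φ 0 * (∫ s in (0:ℝ)..1, g s) + φ 0 ^ 2 := by
      have : (fun s => (g s - φ 0) ^ 2) = fun s => (g s ^ 2 - 2 * φ 0 * g s) + φ 0 ^ 2 := by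
        funext s; ring
      rw [this, intervalIntegral.integral_add, intervalIntegral.integral_sub,
        intervalIntegral.integral_const_mul]
      · simp
      all_goals exact Continuous.intervalIntegrable (by fun_prop) _ _
    rw [e, I1] at h0; nlinarith
  refine I2.trans ?_
  refine intervalIntegral.integral_mono_on (by norm_num)
    (Continuous.intervalIntegrable (by fun_prop) _ _)
    (Continuous.intervalIntegrable (by fun_prop) _ _) ?_
  intro s hs
  obtain ⟨hs0, hs1⟩ := hs
  simp only [hg, mul_pow]
  refine mul_le_mul_of_nonneg_left ?_ (sq_nonneg s)
  set a := φ2 s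
  set b := φ1 s
  set c := φ s
  have cs := fun (p q r : ℝ) (hp : p ^ 2 ≤ 1) (hq : q ^ 2 ≤ 16) (hr : r ^ 2 ≤ 4) =>
    (show (p * a + q * b + r * c) ^ 2 ≤ 21 * (a ^ 2 + b ^ 2 + c ^ 2) by
      have : (p * a + q * b + r * c) ^ 2 ≤ (p ^ 2 + q ^ 2 + r ^ 2) * (a ^ 2 + b ^ 2 + c ^ 2) := by
        nlinarith [sq_nonneg (p * b - q * a), sq_nonneg (p * c - r * a), sq_nonneg (q * c - r * b)]
      refine this.trans (mul_le_mul_of_nonneg_right (by linarith) (by positivity)))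
  have hq : (1 - s) ^ 2 ≤ 1 := by nlinarith
  have := cs ((1 - s) ^ 2) (-4 * (1 - s)) 2 (by nlinarith [sq_nonneg (1 - s)]) (by nlinarith) (by norm_num)
  calc _ = _ := by ring
    _ ≤ _ := this

/-- constant parts of the affine fields -/
def kf : Fin 6 → E3 :=
  ![EuclideanSpace.single 0 1, EuclideanSpace.single 1 1, EuclideanSpace.single 2 1, 0, 0, 0]

def rotf (i j : Fin 3) : E3 →L[ℝ] E3 :=
  (EuclideanSpace.proj i : E3 →L[ℝ] ℝ).smulRight (EuclideanSpace.single j (1:ℝ)) -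
    (EuclideanSpace.proj j : E3 →L[ℝ] ℝ).smulRight (EuclideanSpace.single i (1:ℝ))

/-- linear parts of the affine fields -/
def Af : Fin 6 → (E3 →L[ℝ] E3) := ![0, 0, 0, rotf 1 2, rotf 2 0, rotf 0 1]

def wf (i : Fin 6) (y : E3) : E3 := kf i + Af i y

def Vf (i : Fin 6) (f : E3 → ℝ) (y : E3) : ℝ := fderiv ℝ f y (wf i y)

lemma wf_hasFDerivAt (i : Fin 6) (y : E3) : HasFDerivAt (wf i) (Af i) y :=
  (Af i).hasFDerivAt.const_add _

lemma wf_contDiff (i : Fin 6) : ContDiff ℝ (⊤ : ℕ∞) (wf i) :=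
  contDiff_const.add (Af i).contDiff

lemma Vf_contDiff (i : Fin 6) {f : E3 → ℝ} (hf : ContDiff ℝ (⊤ : ℕ∞) f) :
    ContDiff ℝ (⊤ : ℕ∞) (Vf i f) :=
  (hf.fderiv_right (m := (⊤ : ℕ∞)) (by simp)).clm_apply (wf_contDiff i)

lemma Vf_compact (i : Fin 6) {f : E3 → ℝ} (hf : HasCompactSupport f) :
    HasCompactSupport (Vf i f) := by
  refine (hf.fderiv ℝ).mono ?_
  intro y hy
  contrapose! hy
  simp only [Function.mem_support, not_not] at hy ⊢
  simp [Vf, hy]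

lemma Vf_Vf (i j : Fin 6) {f : E3 → ℝ} (hf : ContDiff ℝ (⊤ : ℕ∞) f) (y : E3) :
    Vf i (Vf j f) y = fderiv ℝ (fderiv ℝ f) y (wf i y) (wf j y) + fderiv ℝ f y (Af j (wf i y)) := by
  have h1 : HasFDerivAt (fderiv ℝ f) (fderiv ℝ (fderiv ℝ f) y) y :=
    (((hf.fderiv_right (m := (⊤ : ℕ∞)) (by simp)).differentiable (by simp)) y).hasFDerivAt
  have := (h1.clm_apply (wf_hasFDerivAt j y)).fderiv
  change fderiv ℝ (fun y => fderiv ℝ f y (wf j y)) y (wf i y) = _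
  rw [this]
  simp [add_comm]

def Ff (f : E3 → ℝ) (y : E3) : ℝ :=
  f y ^ 2 + ∑ i, Vf i f y ^ 2 + ∑ i, ∑ j, Vf i (Vf j f) y ^ 2

lemma Ff_nonneg (f y) : 0 ≤ Ff f y := by unfold Ff; positivity

lemma Ff_cont {f : E3 → ℝ} (hf : ContDiff ℝ (⊤ : ℕ∞) f) : Continuous (Ff f) := by
  have h1 := fun i => (Vf_contDiff i hf).continuous
  have h2 := fun i j => (Vf_contDiff i (Vf_contDiff j hf)).continuous
  have h0 := hf.continuous
  unfold Ff
  fun_prop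

lemma curve (f : E3 → ℝ) (hf : ContDiff ℝ (⊤ : ℕ∞) f) (γ γ1 γ2 : ℝ → E3)
    (h1 : ∀ s, HasDerivAt γ (γ1 s) s) (h2 : ∀ s, HasDerivAt γ1 (γ2 s) s) (hc : Continuous γ2)
    (hw : ∀ s, ∃ c v : Fin 6 → ℝ, (∀ i, |c i| ≤ 2) ∧ (∀ i, |v i| ≤ 2) ∧
      γ1 s = ∑ i, c i • wf i (γ s) ∧
      γ2 s = ∑ i, c i • Af i (γ1 s) + ∑ i, v i • wf i (γ s)) :
    f (γ 0) ^ 2 ≤ ∫ s in (0:ℝ)..1, s ^ 2 * (25725 * Ff f (γ s)) := by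
  have cγ : Continuous γ := continuous_iff_continuousAt.2 fun s => (h1 s).continuousAt
  have cγ1 : Continuous γ1 := continuous_iff_continuousAt.2 fun s => (h2 s).continuousAt
  have hf1 : ContDiff ℝ (⊤ : ℕ∞) (fderiv ℝ f) := hf.fderiv_right (m := (⊤ : ℕ∞)) (by simp)
  have hf2 : ContDiff ℝ (⊤ : ℕ∞) (fderiv ℝ (fderiv ℝ f)) :=
    hf1.fderiv_right (m := (⊤ : ℕ∞)) (by simp)
  have k1 : Continuous (fderiv ℝ f) := hf1.continuous
  have k2 : Continuous (fderiv ℝ (fderiv ℝ f)) := hf2.continuous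
  have d1 : ∀ s, HasDerivAt (fun s => f (γ s)) (fderiv ℝ f (γ s) (γ1 s)) s := fun s =>
    ((hf.differentiable (by simp)) (γ s)).hasFDerivAt.comp_hasDerivAt s (h1 s)
  have d2 : ∀ s, HasDerivAt (fun s => fderiv ℝ f (γ s) (γ1 s))
      (fderiv ℝ (fderiv ℝ f) (γ s) (γ1 s) (γ1 s) + fderiv ℝ f (γ s) (γ2 s)) s := fun s =>
    (((hf1.differentiable (by simp)) (γ s)).hasFDerivAt.comp_hasDerivAt s (h1 s)).clm_apply (h2 s)
  have cF := Ff_cont hf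
  have := oneD (fun s => f (γ s)) _ _ d1 d2 (by fun_prop)
  refine this.trans ?_
  have cf := hf.continuous
  refine intervalIntegral.integral_mono_on (by norm_num)
    (Continuous.intervalIntegrable (by fun_prop) _ _)
    (Continuous.intervalIntegrable (by fun_prop) _ _) ?_
  intro s _
  refine mul_le_mul_of_nonneg_left ?_ (sq_nonneg s)
  obtain ⟨c, v, hc2, hv2, e1, e2⟩ := hw s
  have n1 : 0 ≤ ∑ i, Vf i f (γ s) ^ 2 := by positivity
  have n2 : 0 ≤ ∑ i, ∑ j, Vf i (Vf j f) (γ s) ^ 2 := by positivity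
  have csq : ∀ c : Fin 6 → ℝ, (∀ i, |c i| ≤ 2) → ∑ i, c i ^ 2 ≤ 24 := by
    intro c hc
    calc ∑ i, c i ^ 2 ≤ ∑ i : Fin 6, (4:ℝ) :=
          Finset.sum_le_sum fun i _ => by
            have := hc i; rw [← sq_abs]; nlinarith [abs_nonneg (c i)]
      _ = 24 := by norm_num
  have lin : ∀ c : Fin 6 → ℝ, (∀ i, |c i| ≤ 2) →
      (∑ i, c i * Vf i f (γ s)) ^ 2 ≤ 24 * ∑ i, Vf i f (γ s) ^ 2 := fun c hc =>
    (Finset.sum_mul_sq_le_sq_mul_sq _ _ _).trans (mul_le_mul_of_nonneg_right (csq c hc) n1)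
  have q1 : fderiv ℝ f (γ s) (γ1 s) = ∑ i, c i * Vf i f (γ s) := by
    rw [e1]; simp [Vf]
  have q2 : fderiv ℝ (fderiv ℝ f) (γ s) (γ1 s) (γ1 s) + fderiv ℝ f (γ s) (γ2 s) =
      ∑ i, c i * ∑ j, c j * Vf i (Vf j f) (γ s) + ∑ i, v i * Vf i f (γ s) := by
    have a1 : fderiv ℝ (fderiv ℝ f) (γ s) (γ1 s) (γ1 s) =
        ∑ i, c i * ∑ j, c j * fderiv ℝ (fderiv ℝ f) (γ s) (wf i (γ s)) (wf j (γ s)) := by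
      rw [e1]; simp [map_sum, Finset.mul_sum]
      rw [Finset.sum_comm]
      refine Finset.sum_congr rfl fun i _ => Finset.sum_congr rfl fun j _ => by ring
    have a2 : fderiv ℝ f (γ s) (γ2 s) =
        ∑ i, c i * ∑ j, c j * fderiv ℝ f (γ s) (Af j (wf i (γ s))) + ∑ i, v i * Vf i f (γ s) := by
      rw [e2, e1]; simp [map_sum, Finset.mul_sum, Vf]
      rw [Finset.sum_comm]
      refine Finset.sum_congr rfl fun i _ => Finset.sum_congr rfl fun j _ => by ring
    rw [a1, a2, ← add_assoc, ← Finset.sum_add_distrib]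
    congr 1
    refine Finset.sum_congr rfl fun i _ => ?_
    rw [← mul_add, ← Finset.sum_add_distrib]
    congr 1
    refine Finset.sum_congr rfl fun j _ => ?_
    rw [Vf_Vf i j hf]; ring
  have b1 : (fderiv ℝ f (γ s) (γ1 s)) ^ 2 ≤ 24 * ∑ i, Vf i f (γ s) ^ 2 := by
    rw [q1]; exact lin c hc2
  have b2 : (∑ i, c i * ∑ j, c j * Vf i (Vf j f) (γ s)) ^ 2 ≤
      576 * ∑ i, ∑ j, Vf i (Vf j f) (γ s) ^ 2 := by
    calc _ ≤ (∑ i, c i ^ 2) * ∑ i, (∑ j, c j * Vf i (Vf j f) (γ s)) ^ 2 :=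
          Finset.sum_mul_sq_le_sq_mul_sq _ _ _
      _ ≤ 24 * ∑ i, (24 * ∑ j, Vf i (Vf j f) (γ s) ^ 2) := by
          refine mul_le_mul (csq c hc2) (Finset.sum_le_sum fun i _ => ?_) (by positivity) (by norm_num)
          exact (Finset.sum_mul_sq_le_sq_mul_sq _ _ _).trans
            (mul_le_mul_of_nonneg_right (csq c hc2) (by positivity))
      _ = _ := by rw [← Finset.mul_sum]; ring
  have b3 : (fderiv ℝ (fderiv ℝ f) (γ s) (γ1 s) (γ1 s) + fderiv ℝ f (γ s) (γ2 s)) ^ 2 ≤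
      2 * (576 * ∑ i, ∑ j, Vf i (Vf j f) (γ s) ^ 2) + 2 * (24 * ∑ i, Vf i f (γ s) ^ 2) := by
    rw [q2]
    have := lin v hv2
    have h := add_sq_le (a := ∑ i, c i * ∑ j, c j * Vf i (Vf j f) (γ s))
      (b := ∑ i, v i * Vf i f (γ s))
    linarith
  have n0 := sq_nonneg (f (γ s))
  unfold Ff
  linarith
abbrev P3 : Type := Fin 3 → ℝ

def Dset : Set (Fin 2 → ℝ) := Set.univ.pi fun i => Ioo ((![1/2, 0] : Fin 2 → ℝ) i) ((![1, 1] : Fin 2 → ℝ) i)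

def Qset : Set P3 := (fun p : P3 => (p 0, fun j : Fin 2 => p j.succ)) ⁻¹' (Ioo (0:ℝ) 1 ×ˢ Dset)

lemma Dset_meas : MeasurableSet Dset := MeasurableSet.univ_pi fun _ => measurableSet_Ioo

lemma Dset_vol : volume Dset = ENNReal.ofReal (1/2) := by
  unfold Dset
  rw [Real.volume_pi_Ioo]
  rw [Fin.prod_univ_two, ← ENNReal.ofReal_mul (by norm_num)]
  congr 1
  norm_num

lemma Qset_meas : MeasurableSet Qset := by
  refine MeasurableSet.preimage (measurableSet_Ioo.prod Dset_meas) ?_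
  fun_prop

lemma changeVar (Ψ : P3 → P3) (Ψ' : P3 → P3 →L[ℝ] P3) (κ : ℝ) (hκ : 0 ≤ κ)
    (hd : ∀ p, HasFDerivAt Ψ (Ψ' p) p) (hinj : InjOn Ψ Qset)
    (hdet : ∀ p ∈ Qset, κ * p 0 ^ 2 ≤ |(Ψ' p).det|)
    (G : P3 → ENNReal) (hG : Measurable G) (c : ENNReal)
    (hc : ∀ η ∈ Dset, c ≤ ∫⁻ s in Ioo (0:ℝ) 1, ENNReal.ofReal (s ^ 2) * G (Ψ (Fin.cons s η))) :
    ENNReal.ofReal (κ / 2) * c ≤ ∫⁻ y, G y := by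
  have hΨ : Continuous Ψ := continuous_iff_continuousAt.2 fun p => (hd p).continuousAt
  have s1 : ∫⁻ p in Qset, ENNReal.ofReal (κ * p 0 ^ 2) * G (Ψ p) ≤ ∫⁻ y, G y := by
    calc _ ≤ ∫⁻ p in Qset, ENNReal.ofReal |(Ψ' p).det| * G (Ψ p) := by
          refine setLIntegral_mono' Qset_meas fun p hp => ?_
          gcongr
          exact hdet p hp
      _ = ∫⁻ y in Ψ '' Qset, G y :=
          (lintegral_image_eq_lintegral_abs_det_fderiv_mul volume Qset_meas
            (fun p _ => (hd p).hasFDerivWithinAt) hinj G).symm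
      _ ≤ _ := setLIntegral_le_lintegral _ _
  refine le_trans ?_ s1
  let H : ℝ × (Fin 2 → ℝ) → ENNReal := fun z =>
    ENNReal.ofReal (κ * z.1 ^ 2) * G (Ψ (Fin.cons z.1 z.2))
  have hcons : Measurable (fun z : ℝ × (Fin 2 → ℝ) => (Fin.cons z.1 z.2 : P3)) := by
    refine measurable_pi_iff.2 fun i => ?_
    refine Fin.cases ?_ (fun j => ?_) i
    · simpa using measurable_fst
    · simp only [Fin.cons_succ]
      exact (measurable_pi_apply j).comp measurable_snd
  have hH : Measurable H := by
    refine Measurable.mul (by fun_prop) ?_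
    exact hG.comp (hΨ.measurable.comp hcons)
  have mp := volume_preserving_piFinSuccAbove (fun _ : Fin 3 => ℝ) 0
  have e1 : ∫⁻ p in Qset, ENNReal.ofReal (κ * p 0 ^ 2) * G (Ψ p) =
      ∫⁻ z in (Ioo (0:ℝ) 1 ×ˢ Dset), H z := by
    rw [← mp.setLIntegral_comp_preimage (measurableSet_Ioo.prod Dset_meas) hH]
    have : ∀ p : P3, (MeasurableEquiv.piFinSuccAbove (fun _ : Fin 3 => ℝ) 0) p =
      (p 0, fun j : Fin 2 => p j.succ) := by
      intro p; rfl
    have e2 : ∀ p : P3, H ((MeasurableEquiv.piFinSuccAbove (fun _ : Fin 3 => ℝ) 0) p) =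
        ENNReal.ofReal (κ * p 0 ^ 2) * G (Ψ p) := by
      intro p
      rw [this]
      have : (Fin.cons (p 0) (fun j : Fin 2 => p j.succ) : P3) = p := Fin.cons_self_tail p
      simp only [H, this]
    simp_rw [e2]
    rfl
  rw [e1, Measure.volume_eq_prod, ← Measure.prod_restrict, lintegral_prod_symm' _ hH]
  calc ENNReal.ofReal (κ / 2) * c = ∫⁻ η in Dset, ENNReal.ofReal κ * c := by
        rw [setLIntegral_const, Dset_vol, div_eq_mul_one_div κ 2, ENNReal.ofReal_mul hκ]
        ring
    _ ≤ _ := by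
        refine setLIntegral_mono' Dset_meas fun η hη => ?_
        have : ∀ s, H (s, η) = ENNReal.ofReal κ * (ENNReal.ofReal (s ^ 2) * G (Ψ (Fin.cons s η))) := by
          intro s; simp only [H]; rw [ENNReal.ofReal_mul hκ, mul_assoc]
        simp_rw [this]
        rw [lintegral_const_mul' _ _ ENNReal.ofReal_ne_top]
        gcongr
        exact hc η hη

lemma combine (f : E3 → ℝ) (hf : ContDiff ℝ (⊤ : ℕ∞) f) (hfi : Integrable (Ff f)) (x : E3)
    (L : E3 ≃ₗᵢ[ℝ] E3)
    (Ψ : P3 → P3) (Ψ' : P3 → P3 →L[ℝ] P3) (κ : ℝ) (hκ : 0 ≤ κ)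
    (hd : ∀ p, HasFDerivAt Ψ (Ψ' p) p) (hinj : InjOn Ψ Qset)
    (hdet : ∀ p ∈ Qset, κ * p 0 ^ 2 ≤ |(Ψ' p).det|)
    (h : ∀ η ∈ Dset, ∃ γ γ1 γ2 : ℝ → E3, (∀ s, γ s = L (WithLp.toLp 2 (Ψ (Fin.cons s η)))) ∧ γ 0 = x ∧
      (∀ s, HasDerivAt γ (γ1 s) s) ∧ (∀ s, HasDerivAt γ1 (γ2 s) s) ∧ Continuous γ2 ∧
      (∀ s, ∃ c v : Fin 6 → ℝ, (∀ i, |c i| ≤ 2) ∧ (∀ i, |v i| ≤ 2) ∧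
      γ1 s = ∑ i, c i • wf i (γ s) ∧
      γ2 s = ∑ i, c i • Af i (γ1 s) + ∑ i, v i • wf i (γ s))) :
    κ / 2 * f x ^ 2 ≤ 25725 * ∫ y, Ff f y := by
  have cF := Ff_cont hf
  let G0 : E3 → ENNReal := fun y => ENNReal.ofReal (25725 * Ff f y)
  have mG0 : Measurable G0 := by
    have : Continuous fun y => 25725 * Ff f y := by fun_prop
    exact ENNReal.measurable_ofReal.comp this.measurable
  have mG : Measurable fun p : P3 => G0 (L (WithLp.toLp 2 p)) :=
    mG0.comp (L.continuous.measurable.comp (PiLp.volume_preserving_toLp (Fin 3)).measurable)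
  have key := changeVar Ψ Ψ' κ hκ hd hinj hdet (fun p => G0 (L (WithLp.toLp 2 p))) mG
    (ENNReal.ofReal (f x ^ 2)) ?_
  · have e : ∫⁻ p : P3, G0 (L (WithLp.toLp 2 p)) = ∫⁻ y, G0 y := by
      rw [← (LinearIsometryEquiv.measurePreserving L).lintegral_comp mG0]
      exact (PiLp.volume_preserving_toLp (Fin 3)).lintegral_comp (mG0.comp L.continuous.measurable)
    rw [e, ← ofReal_integral_eq_lintegral_ofReal (hfi.const_mul _)
      (Filter.Eventually.of_forall fun y => by have := Ff_nonneg f y; simp only [Pi.zero_apply]; positivity),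
      ← ENNReal.ofReal_mul (by positivity), integral_const_mul] at key
    refine (ENNReal.ofReal_le_ofReal_iff ?_).1 key
    have : 0 ≤ ∫ y, Ff f y := integral_nonneg (Ff_nonneg f)
    positivity
  · intro η hη
    obtain ⟨γ, γ1, γ2, e, ex, h1, h2, hc, hw⟩ := h η hη
    have := curve f hf γ γ1 γ2 h1 h2 hc hw
    have cγ : Continuous γ := continuous_iff_continuousAt.2 fun s => (h1 s).continuousAt
    rw [ex, intervalIntegral.integral_of_le (by norm_num), integral_Ioc_eq_integral_Ioo] at this
    refine (ENNReal.ofReal_le_ofReal this).trans ?_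
    rw [ofReal_integral_eq_lintegral_ofReal]
    · refine le_of_eq (lintegral_congr fun s => ?_)
      rw [ENNReal.ofReal_mul (sq_nonneg s), ← e]
    · refine IntegrableOn.mono_set (t := Icc 0 1) ?_ Ioo_subset_Icc_self
      exact (Continuous.continuousOn (by fun_prop)).integrableOn_Icc
    · exact Filter.Eventually.of_forall fun s => by
        have := Ff_nonneg f (γ s); simp only [Pi.zero_apply]; positivity
def matL (M : Matrix (Fin 3) (Fin 3) ℝ) : P3 →L[ℝ] P3 :=
  LinearMap.toContinuousLinearMap (Matrix.toLin' M)

lemma matL_det (M : Matrix (Fin 3) (Fin 3) ℝ) : (matL M).det = M.det := by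
  unfold matL
  rw [ContinuousLinearMap.det, LinearMap.coe_toContinuousLinearMap, LinearMap.det_toLin']

lemma matL_apply (M : Matrix (Fin 3) (Fin 3) ℝ) (v : P3) (i : Fin 3) :
    matL M v i = M i 0 * v 0 + M i 1 * v 1 + M i 2 * v 2 := by
  simp [matL, Matrix.mulVec, dotProduct, Fin.sum_univ_three]

lemma Qset_mem {p : P3} (hp : p ∈ Qset) :
    0 < p 0 ∧ p 0 < 1 ∧ 1/2 < p 1 ∧ p 1 < 1 ∧ 0 < p 2 ∧ p 2 < 1 := by
  simp only [Qset, Dset, mem_preimage, mem_prod, mem_Ioo, mem_univ_pi] at hp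
  obtain ⟨⟨h0, h1⟩, h⟩ := hp
  have a := h 0
  have b := h 1
  simp at a b
  refine ⟨h0, h1, ?_, a.2, b.1, b.2⟩
  simpa using a.1

lemma Dset_mem {p : Fin 2 → ℝ} (hp : p ∈ Dset) :
    1/2 < p 0 ∧ p 0 < 1 ∧ 0 < p 1 ∧ p 1 < 1 := by
  simp only [Dset, mem_Ioo, mem_univ_pi] at hp
  have a := hp 0
  have b := hp 1
  simp at a b
  refine ⟨?_, a.2, b.1, b.2⟩
  simpa using a.1

lemma wf_sum (c : Fin 6 → ℝ) (y : E3) : ∑ i, c i • wf i y = WithLp.toLp 2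
    ![c 0 + c 4 * y 2 - c 5 * y 1, c 1 + c 5 * y 0 - c 3 * y 2, c 2 + c 3 * y 1 - c 4 * y 0] := by
  ext k
  fin_cases k <;> simp [Fin.sum_univ_succ, wf, kf, Af, rotf] <;> ring

lemma Af_sum (c : Fin 6 → ℝ) (y : E3) : ∑ i, c i • Af i y = WithLp.toLp 2
    ![c 4 * y 2 - c 5 * y 1, c 5 * y 0 - c 3 * y 2, c 3 * y 1 - c 4 * y 0] := by
  ext k
  fin_cases k <;> simp [Fin.sum_univ_succ, Af, rotf] <;> ring

lemma small (f : E3 → ℝ) (hf : ContDiff ℝ (⊤ : ℕ∞) f) (hfi : Integrable (Ff f)) (x : E3) :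
    1 / 2 * f x ^ 2 ≤ 25725 * ∫ y, Ff f y := by
  refine combine f hf hfi x (LinearIsometryEquiv.refl ℝ E3)
    (fun p => ![x 0 + p 0, x 1 + p 0 * p 1, x 2 + p 0 * p 2])
    (fun p => matL !![1, 0, 0; p 1, p 0, 0; p 2, 0, p 0]) 1 (by norm_num) ?_ ?_ ?_ ?_
  · intro p
    have h := fun i : Fin 3 => hasFDerivAt_apply (𝕜 := ℝ) (F' := fun _ => ℝ) i p
    refine hasFDerivAt_pi'' fun i => ?_
    fin_cases i
    · refine ((h 0).const_add (x 0)).congr_fderiv ?_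
      ext v; simp [matL_apply]
    · refine (((h 0).mul (h 1)).const_add (x 1)).congr_fderiv ?_
      ext v; simp [matL_apply]; ring
    · refine (((h 0).mul (h 2)).const_add (x 2)).congr_fderiv ?_
      ext v; simp [matL_apply]; ring
  · intro p hp q hq e
    have hp' := Qset_mem hp
    have e0 := congrFun e 0
    have e1 := congrFun e 1
    have e2 := congrFun e 2
    simp at e0 e1 e2
    have h0 := hp'.1.ne'
    rw [← e0] at e1 e2
    ext i
    fin_cases i
    · exact e0
    · exact mul_left_cancel₀ h0 e1
    · exact mul_left_cancel₀ h0 e2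
  · intro p hp
    rw [matL_det, Matrix.det_fin_three]
    simp [← sq]
  · intro η hη
    obtain ⟨a1, a2, a3, a4⟩ := Dset_mem hη
    refine ⟨fun s => x + s • WithLp.toLp 2 ![1, η 0, η 1], fun _ => WithLp.toLp 2 ![1, η 0, η 1],
      fun _ => 0, ?_, by simp, ?_, fun s => hasDerivAt_const _ _, continuous_const, ?_⟩
    · intro s
      ext k
      fin_cases k
      · simp
      · simp; try (left; rfl)
      · simp; try (left; rfl)
    · intro s
      simpa using ((hasDerivAt_id s).smul_const (WithLp.toLp 2 ![1, η 0, η 1] : E3)).const_add x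
    · intro s
      refine ⟨![1, η 0, η 1, 0, 0, 0], 0, ?_, by simp, ?_, ?_⟩
      · intro i
        rw [abs_le]
        fin_cases i <;> simp <;> (try constructor) <;> linarith
      · rw [wf_sum]; simp
      · rw [wf_sum, Af_sum]; ext k; fin_cases k <;> simp

lemma large (f : E3 → ℝ) (hf : ContDiff ℝ (⊤ : ℕ∞) f) (hfi : Integrable (Ff f)) (x : E3)
    (hx : 0 < ‖x‖) :
    (‖x‖ ^ 2 * (3 / 8)) / 2 * f x ^ 2 ≤ 25725 * ∫ y, Ff f y := by
  set R := ‖x‖ with hR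
  set L : E3 ≃ₗᵢ[ℝ] E3 := (ℝ ∙ (R • EuclideanSpace.single (0 : Fin 3) (1:ℝ) - x))ᗮ.reflection with hL
  have hLx : L (R • EuclideanSpace.single (0 : Fin 3) (1:ℝ)) = x := by
    rw [hL]
    refine Submodule.reflection_sub ?_
    rw [norm_smul]; simp [hR]
  clear_value L
  refine combine f hf hfi x L
    (fun p => ![(R + p 0) * cos (p 0 * p 1), (R + p 0) * sin (p 0 * p 1) * cos (p 2),
      (R + p 0) * sin (p 0 * p 1) * sin (p 2)])
    (fun p => matL !![cos (p 0 * p 1) - (R + p 0) * (p 1 * sin (p 0 * p 1)),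
        - (R + p 0) * (p 0 * sin (p 0 * p 1)), 0;
      (sin (p 0 * p 1) + (R + p 0) * (p 1 * cos (p 0 * p 1))) * cos (p 2),
        (R + p 0) * (p 0 * cos (p 0 * p 1)) * cos (p 2), - (R + p 0) * sin (p 0 * p 1) * sin (p 2);
      (sin (p 0 * p 1) + (R + p 0) * (p 1 * cos (p 0 * p 1))) * sin (p 2),
        (R + p 0) * (p 0 * cos (p 0 * p 1)) * sin (p 2), (R + p 0) * sin (p 0 * p 1) * cos (p 2)])
    (R ^ 2 * (3 / 8)) (by positivity) ?_ ?_ ?_ ?_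
  · intro p
    have h := fun i : Fin 3 => hasFDerivAt_apply (𝕜 := ℝ) (F' := fun _ => ℝ) i p
    have hr := (h 0).const_add R
    have hm := (h 0).mul (h 1)
    refine hasFDerivAt_pi'' fun i => ?_
    fin_cases i
    · refine (hr.mul hm.cos).congr_fderiv ?_
      ext v; simp [matL_apply]; ring
    · refine ((hr.mul hm.sin).mul (h 2).cos).congr_fderiv ?_
      ext v; simp [matL_apply]; ring
    · refine ((hr.mul hm.sin).mul (h 2).sin).congr_fderiv ?_
      ext v; simp [matL_apply]; ring
  · intro p hp q hq e
    obtain ⟨p0, p0', p1, p1', p2, p2'⟩ := Qset_mem hp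
    obtain ⟨q0, q0', q1, q1', q2, q2'⟩ := Qset_mem hq
    have e0 := congrFun e 0
    have e1 := congrFun e 1
    have e2 := congrFun e 2
    simp only [Matrix.cons_val_zero, Matrix.cons_val_one, Matrix.cons_val] at e0 e1 e2
    have sq : (R + p 0) ^ 2 = (R + q 0) ^ 2 := by
      have A : ∀ r a b : ℝ, r ^ 2 = (r * cos a) ^ 2 + (r * sin a * cos b) ^ 2
          + (r * sin a * sin b) ^ 2 := by
        intro r a b
        have h1 := sin_sq_add_cos_sq a
        have h2 := sin_sq_add_cos_sq b
        linear_combination (-r ^ 2) * h1 - (r * sin a) ^ 2 * h2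
      rw [A _ (p 0 * p 1) (p 2), A (R + q 0) (q 0 * q 1) (q 2), e0, e1, e2]
    have E0 : p 0 = q 0 := by
      have := (pow_left_inj₀ (by positivity) (by positivity) two_ne_zero).1 sq
      linarith
    have hRp : R + p 0 ≠ 0 := by positivity
    rw [← E0] at e0 e1 e2
    have pi3 := Real.pi_gt_three
    have hpp : 0 < p 0 * p 1 := by positivity
    have hpp1 : p 0 * p 1 < 1 := by nlinarith
    have hqq : 0 < p 0 * q 1 := by positivity
    have hqq1 : p 0 * q 1 < 1 := by nlinarith
    have E1' := injOn_cos ⟨hpp.le, by linarith⟩ ⟨hqq.le, by linarith⟩ (mul_left_cancel₀ hRp e0)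
    have E1 := mul_left_cancel₀ p0.ne' E1'
    rw [← E1] at e1
    have hs : sin (p 0 * p 1) ≠ 0 := (sin_pos_of_pos_of_lt_pi hpp (by linarith)).ne'
    have E2 := injOn_cos ⟨p2.le, by linarith⟩ ⟨q2.le, by linarith⟩
      (mul_left_cancel₀ (mul_ne_zero hRp hs) e1)
    ext i
    fin_cases i
    · exact E0
    · exact E1
    · exact E2
  · intro p hp
    obtain ⟨p0, p0', p1, p1', p2, p2'⟩ := Qset_mem hp
    have hpp : 0 < p 0 * p 1 := by positivity
    have hpp1 : p 0 * p 1 < 1 := by nlinarith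
    have hdet : ((R + p 0) ^ 2 * (p 0 * sin (p 0 * p 1))) ≤ |(matL !![cos (p 0 * p 1) - (R + p 0) * (p 1 * sin (p 0 * p 1)),
        - (R + p 0) * (p 0 * sin (p 0 * p 1)), 0;
      (sin (p 0 * p 1) + (R + p 0) * (p 1 * cos (p 0 * p 1))) * cos (p 2),
        (R + p 0) * (p 0 * cos (p 0 * p 1)) * cos (p 2), - (R + p 0) * sin (p 0 * p 1) * sin (p 2);
      (sin (p 0 * p 1) + (R + p 0) * (p 1 * cos (p 0 * p 1))) * sin (p 2),
        (R + p 0) * (p 0 * cos (p 0 * p 1)) * sin (p 2), (R + p 0) * sin (p 0 * p 1) * cos (p 2)]).det| := by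
      refine le_trans (le_of_eq ?_) (le_abs_self _)
      rw [matL_det, Matrix.det_fin_three]
      simp
      have h1 := sin_sq_add_cos_sq (p 0 * p 1)
      have h2 := sin_sq_add_cos_sq (p 2)
      generalize sin (p 0 * p 1) = S at *
      generalize cos (p 0 * p 1) = Cc at *
      generalize sin (p 2) = s at *
      generalize cos (p 2) = c at *
      have hc : c ^ 2 = 1 - s ^ 2 := by linarith
      have hC : Cc ^ 2 = 1 - S ^ 2 := by linarith
      ring_nf
      simp only [hc, hC]
      ring
    refine le_trans ?_ hdet
    have hsin : p 0 * (3 / 8) ≤ sin (p 0 * p 1) := by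
      have := Real.sin_gt_sub_cube hpp
      have h3 : (p 0 * p 1) ^ 3 ≤ p 0 * p 1 := by
        have : (p 0 * p 1) ^ 2 ≤ 1 := by nlinarith
        nlinarith
      nlinarith
    calc R ^ 2 * (3 / 8) * p 0 ^ 2 = R ^ 2 * (p 0 * (p 0 * (3 / 8))) := by ring
      _ ≤ _ := by gcongr; linarith
  · intro η hη
    obtain ⟨a1, a2, a3, a4⟩ := Dset_mem hη
    set k := η 0 with hk
    set ψ := η 1 with hψ
    have hnu : ‖(WithLp.toLp 2 ![0, cos ψ, sin ψ] : E3)‖ = 1 := by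
      rw [EuclideanSpace.norm_eq]; simp [Fin.sum_univ_three]
    have hab' : inner ℝ (EuclideanSpace.single (0 : Fin 3) (1:ℝ)) (WithLp.toLp 2 ![0, cos ψ, sin ψ] : E3) = 0 := by
      rw [EuclideanSpace.inner_single_left]; simp
    obtain ⟨a, ha⟩ : ∃ a, a = L (WithLp.toLp 2 ![0, cos ψ, sin ψ]) := ⟨_, rfl⟩
    obtain ⟨b, hb⟩ : ∃ b, b = L (EuclideanSpace.single (0 : Fin 3) (1:ℝ)) := ⟨_, rfl⟩
    have na : ‖a‖ = 1 := by rw [ha, L.norm_map, hnu]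
    have nb : ‖b‖ = 1 := by rw [hb, L.norm_map]; simp
    have iab : inner ℝ b a = 0 := by rw [ha, hb, L.inner_map_map, hab']
    have nai : ∀ i, |a i| ≤ 1 := fun i => by rw [← na]; exact PiLp.norm_apply_le a i
    have nbi : ∀ i, |b i| ≤ 1 := fun i => by rw [← nb]; exact PiLp.norm_apply_le b i
    have qa : a 0 ^ 2 + a 1 ^ 2 + a 2 ^ 2 = 1 := by
      have := EuclideanSpace.real_norm_sq_eq a
      rw [na] at this; simp [Fin.sum_univ_three] at this; linarith
    have qb : b 0 ^ 2 + b 1 ^ 2 + b 2 ^ 2 = 1 := by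
      have := EuclideanSpace.real_norm_sq_eq b
      rw [nb] at this; simp [Fin.sum_univ_three] at this; linarith
    have qab : a 0 * b 0 + a 1 * b 1 + a 2 * b 2 = 0 := by
      simpa [PiLp.inner_apply, Fin.sum_univ_three] using iab
    have hmul : ∀ s : ℝ, HasDerivAt (fun s => s * k) k s := fun s => by
      simpa using (hasDerivAt_id s).mul_const k
    have hRs : ∀ s : ℝ, HasDerivAt (fun s => R + s) 1 s := fun s => by
      simpa using (hasDerivAt_id s).const_add R
    refine ⟨fun s => (R + s) • (cos (s * k) • b + sin (s * k) • a),
      fun s => (R + s) • ((-sin (s * k) * k) • b + (cos (s * k) * k) • a) +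
        (cos (s * k) • b + sin (s * k) • a),
      fun s => (2 : ℝ) • ((-sin (s * k) * k) • b + (cos (s * k) * k) • a) -
        ((R + s) * k ^ 2) • (cos (s * k) • b + sin (s * k) • a), ?_, ?_, ?_, ?_, by fun_prop, ?_⟩
    · intro s
      rw [ha, hb]
      beta_reduce
      rw [← map_smul, ← map_smul, ← map_add, ← map_smul]
      congr 1
      ext j
      have e1 : (Fin.cons s η : P3) 1 = k := rfl
      have e2 : (Fin.cons s η : P3) 2 = ψ := rfl
      fin_cases j
      · simp [e1, e2]
      · simp [e1, e2]; ring
      · simp [e1, e2]; ring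
    · simp [hb, ← hLx]
    · intro s
      have := (hRs s).smul (((hmul s).cos.smul_const b).add ((hmul s).sin.smul_const a))
      refine this.congr_deriv ?_
      simp only [Pi.add_apply]
      module
    · intro s
      have d1 := (((hmul s).sin.neg.mul_const k).smul_const b).add
        (((hmul s).cos.mul_const k).smul_const a)
      have := ((hRs s).smul d1).add
        (((hmul s).cos.smul_const b).add ((hmul s).sin.smul_const a))
      refine this.congr_deriv ?_
      simp only [Pi.add_apply, Pi.neg_apply]
      module
    · intro s
      have k1 : |k| ≤ 1 := by rw [abs_le]; constructor <;> linarith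
      have hS := abs_sin_le_one (s * k)
      have hC := abs_cos_le_one (s * k)
      have bd : ∀ p q r t : ℝ, |p| ≤ 1 → |q| ≤ 1 → |r| ≤ 1 → |t| ≤ 1 → |p * q + r * t| ≤ 2 := by
        intro p q r t hp hq hr ht
        refine (abs_add_le _ _).trans ?_
        rw [abs_mul, abs_mul]
        have := mul_le_one₀ hp (abs_nonneg q) hq
        have := mul_le_one₀ hr (abs_nonneg t) ht
        linarith
      have bk : ∀ p : ℝ, |p| ≤ 2 → |k * p| ≤ 2 := by
        intro p hp; rw [abs_mul]; nlinarith [abs_nonneg p, abs_nonneg k]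
      have bm : ∀ i j, |k * (b i * a j + (- b j) * a i)| ≤ 2 := fun i j =>
        bk _ (bd _ _ _ _ (nbi i) (nai j) (by rw [abs_neg]; exact nbi j) (nai i))
      have bn : ∀ i, |cos (s * k) * b i + sin (s * k) * a i| ≤ 2 := fun i =>
        bd _ _ _ _ hC (nbi i) hS (nai i)
      have bv : ∀ i, |k * (cos (s * k) * a i + (- sin (s * k)) * b i)| ≤ 2 := fun i =>
        bk _ (bd _ _ _ _ hC (nai i) (by rw [abs_neg]; exact hS) (nbi i))
      refine ⟨![cos (s * k) * b 0 + sin (s * k) * a 0, cos (s * k) * b 1 + sin (s * k) * a 1,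
        cos (s * k) * b 2 + sin (s * k) * a 2, k * (b 1 * a 2 + (- b 2) * a 1),
        k * (b 2 * a 0 + (- b 0) * a 2), k * (b 0 * a 1 + (- b 1) * a 0)],
        ![k * (cos (s * k) * a 0 + (- sin (s * k)) * b 0),
        k * (cos (s * k) * a 1 + (- sin (s * k)) * b 1),
        k * (cos (s * k) * a 2 + (- sin (s * k)) * b 2), 0, 0, 0], ?_, ?_, ?_, ?_⟩
      · intro i
        fin_cases i
        · exact bn 0
        · exact bn 1
        · exact bn 2
        · exact bm 1 2
        · exact bm 2 0
        · exact bm 0 1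
      · intro i
        fin_cases i
        · exact bv 0
        · exact bv 1
        · exact bv 2
        all_goals simp
      · rw [wf_sum]
        ext j
        fin_cases j
        · simp
          linear_combination (-(k * (R + s))) * (a 0 * (cos (s * k) * qb + sin (s * k) * qab) - b 0 * (cos (s * k) * qab + sin (s * k) * qa))
        · simp
          linear_combination (-(k * (R + s))) * (a 1 * (cos (s * k) * qb + sin (s * k) * qab) - b 1 * (cos (s * k) * qab + sin (s * k) * qa))
        · simp
          linear_combination (-(k * (R + s))) * (a 2 * (cos (s * k) * qb + sin (s * k) * qab) - b 2 * (cos (s * k) * qab + sin (s * k) * qa))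
      · rw [wf_sum, Af_sum]
        ext j
        fin_cases j
        · simp
          linear_combination (-k) * (a 0 * ((cos (s * k) - (R + s) * k * sin (s * k)) * qb + (sin (s * k) + (R + s) * k * cos (s * k)) * qab) - b 0 * ((cos (s * k) - (R + s) * k * sin (s * k)) * qab + (sin (s * k) + (R + s) * k * cos (s * k)) * qa))
        · simp
          linear_combination (-k) * (a 1 * ((cos (s * k) - (R + s) * k * sin (s * k)) * qb + (sin (s * k) + (R + s) * k * cos (s * k)) * qab) - b 1 * ((cos (s * k) - (R + s) * k * sin (s * k)) * qab + (sin (s * k) + (R + s) * k * cos (s * k)) * qa))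
        · simp
          linear_combination (-k) * (a 2 * ((cos (s * k) - (R + s) * k * sin (s * k)) * qb + (sin (s * k) + (R + s) * k * cos (s * k)) * qab) - b 2 * ((cos (s * k) - (R + s) * k * sin (s * k)) * qab + (sin (s * k) + (R + s) * k * cos (s * k)) * qa))
lemma slice_fderiv {U : Pt → ℝ} (hU : ContDiff ℝ (⊤ : ℕ∞) U) (t : ℝ) (y v : E3) :
    fderiv ℝ (fun z : E3 => U (t, z)) y v = fderiv ℝ U (t, y) (0, v) := by
  have h : HasFDerivAt (fun z : E3 => (t, z)) (ContinuousLinearMap.inr ℝ ℝ E3) y :=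
    hasFDerivAt_prodMk_right t y
  have := (((hU.differentiable (by simp)) (t, y)).hasFDerivAt.comp y h).fderiv
  have e : fderiv ℝ (fun z : E3 => U (t, z)) y =
    (fderiv ℝ U (t, y)).comp (ContinuousLinearMap.inr ℝ ℝ E3) := this
  rw [e]; simp

lemma Gam_slice (i : Fin 6) {U : Pt → ℝ} (hU : ContDiff ℝ (⊤ : ℕ∞) U) (t : ℝ) (y : E3) :
    Gam i.succ.castSucc U (t, y) = Vf i (fun z => U (t, z)) y := by
  have h := fun k : Fin 3 => slice_fderiv hU t y (EuclideanSpace.single k (1:ℝ))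
  fin_cases i
  · simp [Vf, wf, kf, Af, h]; rfl
  · simp [Vf, wf, kf, Af, h]; rfl
  · simp [Vf, wf, kf, Af, h]; rfl
  · simp [Vf, wf, kf, Af, rotf, h]; rfl
  · simp [Vf, wf, kf, Af, rotf, h]; rfl
  · simp [Vf, wf, kf, Af, rotf, h]; rfl

lemma dxi_contDiff (k : Fin 3) {U : Pt → ℝ} (hU : ContDiff ℝ (⊤ : ℕ∞) U) :
    ContDiff ℝ (⊤ : ℕ∞) (dxi k U) :=
  (hU.fderiv_right (m := (⊤ : ℕ∞)) (by simp)).clm_apply contDiff_const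

lemma Gam_contDiff (i : Fin 6) {U : Pt → ℝ} (hU : ContDiff ℝ (⊤ : ℕ∞) U) :
    ContDiff ℝ (⊤ : ℕ∞) (Gam i.succ.castSucc U) := by
  have hd := fun k => dxi_contDiff k hU
  have hp : ∀ k : Fin 3, ContDiff ℝ (⊤ : ℕ∞) (fun p : Pt => p.2 k) := fun k =>
    (EuclideanSpace.proj k : E3 →L[ℝ] ℝ).contDiff.comp contDiff_snd
  fin_cases i
  · exact hd 0
  · exact hd 1
  · exact hd 2
  · exact ((hp 1).mul (hd 2)).sub ((hp 2).mul (hd 1))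
  · exact ((hp 2).mul (hd 0)).sub ((hp 0).mul (hd 2))
  · exact ((hp 0).mul (hd 1)).sub ((hp 1).mul (hd 0))

lemma L2norm_nonneg (f : E3 → ℝ) : 0 ≤ L2norm f := Real.sqrt_nonneg _

lemma word_le (u : Pt → ℝ) (t : ℝ) (n : ℕ) (hn : n < 3) (a : Fin n → Fin 8) :
    L2norm (fun y : E3 => GamWord (List.ofFn a) u (t, y)) ≤
      ∑ n ∈ Finset.range 3, ∑ a : Fin n → Fin 8,
            L2norm (fun y : E3 => GamWord (List.ofFn a) u (t, y)) := by
  have h1 := Finset.single_le_sum (f := fun a : Fin n → Fin 8 =>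
    L2norm (fun y : E3 => GamWord (List.ofFn a) u (t, y))) (fun a _ => L2norm_nonneg _)
    (Finset.mem_univ a)
  have h2 := Finset.single_le_sum (f := fun n : ℕ => ∑ a : Fin n → Fin 8,
    L2norm (fun y : E3 => GamWord (List.ofFn a) u (t, y)))
    (fun n _ => Finset.sum_nonneg fun a _ => L2norm_nonneg _) (Finset.mem_range.2 hn)
  exact h1.trans h2

lemma int_sq_le {f : E3 → ℝ} {T : ℝ} (h : L2norm f ≤ T) : ∫ y, f y ^ 2 ≤ T ^ 2 := by
  have h0 : 0 ≤ ∫ y, f y ^ 2 := integral_nonneg fun y => sq_nonneg _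
  calc ∫ y, f y ^ 2 = (L2norm f) ^ 2 := (Real.sq_sqrt h0).symm
    _ ≤ T ^ 2 := pow_le_pow_left₀ (L2norm_nonneg f) h 2

lemma sq_integrable {f : E3 → ℝ} (hf : Continuous f) (hc : HasCompactSupport f) :
    Integrable fun y => f y ^ 2 := by
  refine (hf.pow 2).integrable_of_hasCompactSupport (hc.mono ?_)
  intro y hy hy'
  exact hy (by simp [hy'])

/-- **Klainerman–Sobolev type inequality** (Lemma 2.1): there is `C > 0` such that for
every smooth `u` on `[0,∞) × ℝ³` with `u(t,·)` compactly supported,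
`|u(t,x)| ≤ C (1+r)⁻¹ Σ_{|a|≤2} ‖Γ^a u(t,·)‖`. -/
theorem klainerman_sobolev :
    ∃ C > 0, ∀ u : Pt → ℝ, ContDiff ℝ (⊤ : ℕ∞) u →
      (∀ t : ℝ, HasCompactSupport (fun x : E3 => u (t, x))) →
      ∀ t : ℝ, 0 ≤ t → ∀ x : E3,
        |u (t, x)| ≤ C * (1 + ‖x‖)⁻¹ *
          ∑ n ∈ Finset.range 3, ∑ a : Fin n → Fin 8,
            L2norm (fun y : E3 => GamWord (List.ofFn a) u (t, y)) := by
  refine ⟨6000, by norm_num, ?_⟩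
  intro u hu hsupp t _ x
  have hT1 := word_le u t
  set T := ∑ n ∈ Finset.range 3, ∑ a : Fin n → Fin 8,
            L2norm (fun y : E3 => GamWord (List.ofFn a) u (t, y)) with hT
  clear_value T
  obtain ⟨f, hfdef⟩ : ∃ f : E3 → ℝ, f = fun y => u (t, y) := ⟨_, rfl⟩
  have hf : ContDiff ℝ (⊤ : ℕ∞) f := by
    rw [hfdef]; exact hu.comp (contDiff_const.prodMk contDiff_id)
  have hfc : HasCompactSupport f := by rw [hfdef]; exact hsupp t
  have w0 : L2norm f ≤ T := by
    have := hT1 0 (by norm_num) ![]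
    rw [hfdef]; simpa [GamWord] using this
  have w1 : ∀ i, L2norm (Vf i f) ≤ T := fun i => by
    have := hT1 1 (by norm_num) ![i.succ.castSucc]
    have e : (fun y : E3 => GamWord (List.ofFn ![i.succ.castSucc]) u (t, y)) = Vf i f := by
      funext y
      rw [hfdef, ← Gam_slice i hu]; simp [GamWord]
    rwa [e] at this
  have w2 : ∀ i j, L2norm (Vf i (Vf j f)) ≤ T := fun i j => by
    have := hT1 2 (by norm_num) ![i.succ.castSucc, j.succ.castSucc]
    have e : (fun y : E3 => GamWord (List.ofFn ![i.succ.castSucc, j.succ.castSucc]) u (t, y)) =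
        Vf i (Vf j f) := by
      have e0 : Vf j f = fun y => Gam j.succ.castSucc u (t, y) := by
        funext y
        rw [hfdef, ← Gam_slice j hu]
      funext y
      rw [e0, ← Gam_slice i (Gam_contDiff j hu)]; simp [GamWord]
    rwa [e] at this
  have hT0 : 0 ≤ T := (L2norm_nonneg _).trans w0
  have i0 := sq_integrable hf.continuous hfc
  have i1 := fun i => sq_integrable (Vf_contDiff i hf).continuous (Vf_compact i hfc)
  have i2 := fun i j => sq_integrable (Vf_contDiff i (Vf_contDiff j hf)).continuous
    (Vf_compact i (Vf_compact j hfc))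
  have I1 : Integrable fun y => ∑ i, Vf i f y ^ 2 := integrable_finsetSum _ fun i _ => i1 i
  have I2' : ∀ i, Integrable fun y => ∑ j, Vf i (Vf j f) y ^ 2 := fun i =>
    integrable_finsetSum _ fun j _ => i2 i j
  have I2 : Integrable fun y => ∑ i, ∑ j, Vf i (Vf j f) y ^ 2 :=
    integrable_finsetSum _ fun i _ => I2' i
  have hfi : Integrable (Ff f) := (i0.add I1).add I2
  have hF : ∫ y, Ff f y ≤ 43 * T ^ 2 := by
    have e : ∫ y, Ff f y = (∫ y, f y ^ 2) + (∑ i, ∫ y, Vf i f y ^ 2) +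
        ∑ i, ∑ j, ∫ y, Vf i (Vf j f) y ^ 2 := by
      unfold Ff
      rw [integral_add (f := fun y => f y ^ 2 + ∑ i, Vf i f y ^ 2) (i0.add I1) I2, integral_add i0 I1, integral_finsetSum _ fun i _ => i1 i,
        integral_finsetSum _ fun i _ => I2' i]
      congr 1
      exact Finset.sum_congr rfl fun i _ => integral_finsetSum _ fun j _ => i2 i j
    rw [e]
    have s1 : ∑ i, ∫ y, Vf i f y ^ 2 ≤ ∑ i : Fin 6, T ^ 2 :=
      Finset.sum_le_sum fun i _ => int_sq_le (w1 i)
    have s2 : ∑ i, ∑ j, ∫ y, Vf i (Vf j f) y ^ 2 ≤ ∑ i : Fin 6, ∑ j : Fin 6, T ^ 2 :=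
      Finset.sum_le_sum fun i _ => Finset.sum_le_sum fun j _ => int_sq_le (w2 i j)
    have s0 := int_sq_le w0
    simp at s1 s2
    linarith
  have ux : u (t, x) = f x := by rw [hfdef]
  rw [ux]
  have hpos : 0 < 1 + ‖x‖ := by positivity
  rw [mul_right_comm, ← div_eq_mul_inv, le_div_iff₀ hpos]
  refine abs_le_of_sq_le_sq' ?_ (by positivity) |>.2
  rw [mul_pow, sq_abs, mul_pow]
  have hfx := sq_nonneg (f x)
  rcases le_total ‖x‖ 1 with h | h
  · have := small f hf hfi x
    have h2 : (1 + ‖x‖) ^ 2 ≤ 4 := by nlinarith [norm_nonneg x]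
    have := mul_le_mul_of_nonneg_left h2 hfx
    nlinarith [sq_nonneg T]
  · have := large f hf hfi x (by linarith)
    have h2 : (1 + ‖x‖) ^ 2 ≤ 4 * ‖x‖ ^ 2 := by nlinarith
    have := mul_le_mul_of_nonneg_left h2 hfx
    nlinarith [sq_nonneg T]
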